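/- Let μ be a probability measure on G = (ℤ/2ℤ)³ with a_max = μ({0}) and a_max > 1/4, and suppose μ ∈ TEC(G). Then there is a decomposition G = X₁ ⊕ X₂ (X₁ ∈ 𝔄₁ with X₁ = {0,g}, X₂ ∈ 𝔄₂, X₁ ∩ X₂ = {0}) such that at least one of the following four conditions holds. (II.1) For every K ∈ 𝔄₂: (μ ∈ U(K) or μ ∈ U(K̄)) and (μ ∈ V(K) or μ ∈ V(K̄)). (II.2) μ ∈ W(X₁,K) for at least one K ∈ 𝔄₂ with g ∉ K, and for every K ∈ 𝔄₂ with g ∉ K: μ ∈ U(K) or μ ∈ U(K̄). (II.3) There is a two-element subset E ⊆ X₂ with μ(g' + E) = μ(g' + (X₂ \ E)) for both g' ∈ X₁, and for every K ∈ 𝔄₂ with K ≠ X₂: μ ∈ U(K) or μ ∈ U(K̄). (II.4) μ(X₂) = 1/2; for every K ∈ 𝔄₂ with K ≠ X₂: μ ∈ V(K) or μ ∈ V(K̄); and for every K ∈ 𝔄₂: μ ∈ U(K) or μ ∈ U(K̄). -/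

import Mathlib

open scoped BigOperators

/-- The group `G = (ℤ/2ℤ)³`. -/
abbrev G : Type := ZMod 2 × ZMod 2 × ZMod 2

/-- The character pairing `(x,y) = (-1)^(x₁y₁+x₂y₂+x₃y₃)`. -/
noncomputable def pairing (x y : G) : ℝ :=
  (-1 : ℝ) ^ (x.1.val * y.1.val + x.2.1.val * y.2.1.val + x.2.2.val * y.2.2.val)

/-- A probability measure on `G`, given by its mass function. -/
def IsProb (p : G → ℝ) : Prop := (∀ x, 0 ≤ p x) ∧ ∑ x : G, p x = 1

/-- The characteristic function `μ̂(y) = Σ_x (x,y) μ({x})`. -/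
noncomputable def charFn (p : G → ℝ) (y : G) : ℝ := ∑ x : G, pairing x y * p x

/-- The measure of a set `E ⊆ G`. -/
noncomputable def measOf (p : G → ℝ) (E : Set G) : ℝ := ∑ x : G, E.indicator p x

/-- `μ` has a trivial equivalence class: every probability measure `ν` with
`|ν̂| = |μ̂|` is a shift `μₓ` of `μ` (central symmetry is the identity on `G`). -/
def TEC (p : G → ℝ) : Prop :=
  ∀ q : G → ℝ, IsProb q → (∀ y : G, |charFn q y| = |charFn p y|) →
    ∃ x : G, ∀ e : G, q e = p (e + x)

/-- `u(E) = max_{x ∈ E} μ({x})`. -/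
noncomputable def uOf (p : G → ℝ) (E : Set G) : ℝ := sSup (p '' E)

/-- `v(E) = min_{x ∈ E} μ({x})`. -/
noncomputable def vOf (p : G → ℝ) (E : Set G) : ℝ := sInf (p '' E)

/-- `μ ∈ U(E)` iff `2 u(E) > μ(E)`. -/
def USet (p : G → ℝ) (E : Set G) : Prop := measOf p E < 2 * uOf p E

/-- `μ ∈ V(E)` iff `1/2 + 2 v(E) < μ(E)`. -/
def VSet (p : G → ℝ) (E : Set G) : Prop := 1/2 + 2 * vOf p E < measOf p E

/-- `μ ∈ W({0,g}, K)`: for each of the three order-4 subgroups `L` containing `g`,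
writing `L = {0, g, s, t}` with `s` the nonzero element of `L ∩ K` and `t` the element
of `L ∩ K̄` distinct from `g`, one has `μ({0,t}) = μ({g,s})`. -/
def WCond (p : G → ℝ) (g : G) (K : AddSubgroup G) : Prop :=
  ∀ L : AddSubgroup G, Nat.card L = 4 → g ∈ L →
    ∀ s t : G, s ∈ L → s ∈ K → s ≠ 0 → t ∈ L → t ∉ K → t ≠ g →
      p 0 + p t = p g + p s

/-- The bilinear form on `G` with values in `ZMod 2` underlying `pairing`. -/
def dot (x y : G) : ZMod 2 := x.1 * y.1 + x.2.1 * y.2.1 + x.2.2 * y.2.2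

/-- The integer-valued sign character `(-1)^(dot x y)`. -/
def sgn (x y : G) : ℤ := if dot x y = 0 then 1 else -1

lemma pairing_eq_sgn (x y : G) : pairing x y = (sgn x y : ℝ) := by
  have h : ((x.1.val * y.1.val + x.2.1.val * y.2.1.val + x.2.2.val * y.2.2.val : ℕ) : ZMod 2)
      = dot x y := by
    simp [dot]
  unfold pairing sgn
  simp only [← h, ZMod.natCast_eq_zero_iff_even]
  split_ifs with h
  · simp [h.neg_one_pow]
  · simp [(Nat.not_even_iff_odd.1 h).neg_one_pow]

lemma dot_comm (x y : G) : dot x y = dot y x := by unfold dot; ring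

lemma dot_add_left (x e y : G) : dot (x + e) y = dot x y + dot e y := by
  simp only [dot, Prod.fst_add, Prod.snd_add]; ring

lemma dot_add_right (x y z : G) : dot x (y + z) = dot x y + dot x z := by
  rw [dot_comm, dot_add_left, dot_comm y, dot_comm z]

lemma dot_zero_left (y : G) : dot 0 y = 0 := by simp [dot]

lemma dot_eq_zero_or_one (x y : G) : dot x y = 0 ∨ dot x y = 1 := by
  generalize dot x y = d
  revert d; decide

lemma add_self_cancel (x : G) : x + x = 0 := by
  revert x; decide

lemma pairing_of_dot_eq_zero {x y : G} (h : dot x y = 0) : pairing x y = 1 := by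
  simp [pairing_eq_sgn, sgn, h]

lemma pairing_of_dot_eq_one {x y : G} (h : dot x y = 1) : pairing x y = -1 := by
  simp [pairing_eq_sgn, sgn, h]

lemma pairing_comm (x y : G) : pairing x y = pairing y x := by
  simp [pairing_eq_sgn, sgn, dot_comm]

lemma pairing_add_left (x e y : G) : pairing (x + e) y = pairing x y * pairing e y := by
  rcases dot_eq_zero_or_one x y with h | h <;> rcases dot_eq_zero_or_one e y with h' | h' <;>
    simp [pairing_eq_sgn, sgn, dot_add_left, h, h', CharTwo.add_self_eq_zero]

lemma sum_pairing (z : G) : ∑ x : G, pairing x z = if z = 0 then 8 else 0 := by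
  have h : ∀ z : G, ∑ x : G, sgn x z = if z = 0 then 8 else 0 := by decide +kernel
  simp only [pairing_eq_sgn]
  exact_mod_cast h z

lemma add_eq_zero_iff_eq (y z : G) : y + z = 0 ↔ y = z := by
  revert y z; decide

lemma sum_pairing_mul_pairing (y z : G) :
    ∑ x : G, pairing x y * pairing x z = if z = y then 8 else 0 := by
  have h (x : G) : pairing x y * pairing x z = pairing x (z + y) := by
    rw [pairing_comm x y, pairing_comm x z, pairing_comm x, pairing_add_left, mul_comm]
  simp only [h, sum_pairing, add_eq_zero_iff_eq]

lemma fourier_inversion (p : G → ℝ) (e : G) :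
    p e = 1 / 8 * ∑ y : G, pairing e y * charFn p y := by
  have h : ∑ y : G, pairing e y * charFn p y = 8 * p e := by
    simp only [charFn, Finset.mul_sum]
    rw [Finset.sum_comm]
    have h1 (x : G) : ∑ y : G, pairing e y * (pairing x y * p x) =
        (if x = e then 8 else 0) * p x := by
      rw [← sum_pairing_mul_pairing, Finset.sum_mul]
      refine Finset.sum_congr rfl fun y _ => ?_
      rw [pairing_comm y e, pairing_comm y x, mul_assoc]
    simp [h1]
  rw [h]; ring

lemma charFn_zero {p : G → ℝ} (hp : IsProb p) : charFn p 0 = 1 := by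
  rw [← hp.2]
  refine Finset.sum_congr rfl fun x _ => ?_
  rw [pairing_of_dot_eq_zero (by rw [dot_comm, dot_zero_left]), one_mul]

lemma charFn_shift (p : G → ℝ) (x z : G) :
    charFn (fun e => p (e + x)) z = pairing x z * charFn p z := by
  unfold charFn
  rw [Finset.mul_sum, ← Equiv.sum_comp (Equiv.addRight x)]
  refine Finset.sum_congr rfl fun e _ => ?_
  simp only [Equiv.coe_addRight, add_assoc, add_self_cancel, add_zero, pairing_add_left]
  ring

/-- Transform of an affine combination of `p`, the constant function and a character. -/
lemma charFn_combination (p : G → ℝ) (a b c : ℝ) (y z : G) :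
    charFn (fun e => a + b * pairing e y + c * p e) z =
      a * (if z = 0 then 8 else 0) + b * (if z = y then 8 else 0) + c * charFn p z := by
  rw [← sum_pairing, ← sum_pairing_mul_pairing]
  simp only [charFn, Finset.mul_sum, ← Finset.sum_add_distrib]
  refine Finset.sum_congr rfl fun e _ => ?_
  ring

/-- The hyperplane orthogonal to `y`. -/
def orth (y : G) : AddSubgroup G where
  carrier := {x | dot x y = 0}
  zero_mem' := dot_zero_left y
  add_mem' {a b} ha hb := by
    simp only [Set.mem_ofPred_eq] at *
    rw [dot_add_left, ha, hb, add_zero]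
  neg_mem' {a} ha := by
    have h : -a = a := by clear ha; revert a; decide
    rwa [h]

lemma mem_orth {x y : G} : x ∈ orth y ↔ dot x y = 0 := Iff.rfl

lemma not_mem_orth {x y : G} : x ∉ orth y ↔ dot x y = 1 := by
  rw [mem_orth]
  rcases dot_eq_zero_or_one x y with h | h <;> simp [h]

/-- The subgroup `{0, g}`. -/
def line (g : G) : AddSubgroup G where
  carrier := {x | x = 0 ∨ x = g}
  zero_mem' := Or.inl rfl
  add_mem' {a b} ha hb := by
    rcases ha with rfl | rfl <;> rcases hb with rfl | rfl <;> simp [add_self_cancel]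
  neg_mem' {a} ha := by
    have h : -a = a := by clear ha; revert a; decide
    rwa [h]

lemma mem_line {x g : G} : x ∈ line g ↔ x = 0 ∨ x = g := Iff.rfl

lemma card_line {g : G} (hg : g ≠ 0) : Nat.card (line g) = 2 := by
  have h : ((line g : AddSubgroup G) : Set G) = {0, g} := by ext; rfl
  exact (congrArg Set.ncard h).trans (Set.ncard_pair hg.symm)

lemma card_orth {y : G} (hy : y ≠ 0) : Nat.card (orth y) = 4 := by
  have h : ∀ y : G, y ≠ 0 → (Finset.univ.filter fun x : G => dot x y = 0).card = 4 := by
    decide +kernel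
  rw [← h y hy, ← Set.ncard_coe_finset]
  simp only [Finset.coe_filter, Finset.mem_univ, true_and]
  rfl

lemma exists_eq_orth {K : AddSubgroup G} (hK : Nat.card K = 4) : ∃ y : G, y ≠ 0 ∧ K = orth y := by
  classical
  have hidx : K.index = 2 := by
    have h := K.card_mul_index
    have h8 : Nat.card G = 8 := by simp [Nat.card_eq_fintype_card]
    rw [hK, h8] at h
    omega
  have hadd (a b : G) := AddSubgroup.add_mem_iff_of_index_two hidx (a := a) (b := b)
  let y : G := (if ((1, 0, 0) : G) ∈ K then 0 else 1, if ((0, 1, 0) : G) ∈ K then 0 else 1,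
    if ((0, 0, 1) : G) ∈ K then 0 else 1)
  have hKy : K = orth y := by
    have h0 : ∀ a : ZMod 2, a = 0 ∨ a = 1 := by decide
    ext ⟨a, b, c⟩
    have hsplit : ((a, b, c) : G) = (a, 0, 0) + ((0, b, 0) + (0, 0, c)) := by simp
    have hz : ((0, 0, 0) : G) ∈ K := K.zero_mem
    rw [hsplit, hadd, hadd, ← hsplit, mem_orth]
    rcases h0 a with rfl | rfl <;> rcases h0 b with rfl | rfl <;> rcases h0 c with rfl | rfl <;>
      by_cases h1 : ((1, 0, 0) : G) ∈ K <;> by_cases h2 : ((0, 1, 0) : G) ∈ K <;>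
      by_cases h3 : ((0, 0, 1) : G) ∈ K <;> simp [h1, h2, h3, hz, dot, y] <;> decide
  refine ⟨y, fun h => ?_, hKy⟩
  have htop : K = ⊤ := by
    rw [hKy, h, eq_top_iff]
    intro x _
    rw [mem_orth, dot_comm, dot_zero_left]
  rw [htop, AddSubgroup.index_top] at hidx
  omega

lemma line_inf_orth {g y : G} (h : dot g y = 1) : line g ⊓ orth y = ⊥ := by
  rw [eq_bot_iff]
  rintro x ⟨hx, hxy⟩
  rcases hx with rfl | rfl
  · exact AddSubgroup.zero_mem _
  · exact absurd hxy (not_mem_orth.2 h)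

lemma line_sup_orth {g y : G} (h : dot g y = 1) : line g ⊔ orth y = ⊤ := by
  rw [eq_top_iff]
  intro x _
  rcases dot_eq_zero_or_one x y with hx | hx
  · exact AddSubgroup.mem_sup_right hx
  · have hmem : g + x ∈ orth y := by
      rw [mem_orth, dot_add_left, h, hx]; decide
    have := AddSubgroup.add_mem_sup (mem_line.2 (Or.inr rfl) : g ∈ line g) hmem
    rwa [← add_assoc, add_self_cancel, zero_add] at this

lemma USet_iff {p : G → ℝ} {E : Set G} (hE : E.Nonempty) :
    USet p E ↔ ∃ e ∈ E, measOf p E < 2 * p e := by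
  have hfin : (p '' E).Finite := Set.toFinite _
  unfold USet uOf
  constructor
  · intro h
    obtain ⟨e, he, hpe⟩ := (hE.image p).csSup_mem hfin
    exact ⟨e, he, by rwa [hpe]⟩
  · rintro ⟨e, he, h⟩
    have := le_csSup hfin.bddAbove (Set.mem_image_of_mem p he)
    linarith

lemma VSet_iff {p : G → ℝ} {E : Set G} (hE : E.Nonempty) :
    VSet p E ↔ ∃ e ∈ E, 1 / 2 + 2 * p e < measOf p E := by
  have hfin : (p '' E).Finite := Set.toFinite _
  unfold VSet vOf
  constructor
  · intro h
    obtain ⟨e, he, hpe⟩ := (hE.image p).csInf_mem hfin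
    exact ⟨e, he, by rwa [hpe]⟩
  · rintro ⟨e, he, h⟩
    have := csInf_le hfin.bddBelow (Set.mem_image_of_mem p he)
    linarith

lemma measOf_orth {p : G → ℝ} (hp : IsProb p) (y : G) :
    measOf p (orth y : Set G) = (1 + charFn p y) / 2 := by
  rw [← hp.2, charFn, ← Finset.sum_add_distrib, Finset.sum_div, measOf]
  refine Finset.sum_congr rfl fun x _ => ?_
  rcases dot_eq_zero_or_one x y with h | h
  · rw [Set.indicator_of_mem (mem_orth.2 h), pairing_of_dot_eq_zero h]; ring
  · rw [Set.indicator_of_notMem (not_mem_orth.2 h), pairing_of_dot_eq_one h]; ring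

lemma measOf_orth_compl {p : G → ℝ} (hp : IsProb p) (y : G) :
    measOf p (orth y : Set G)ᶜ = (1 - charFn p y) / 2 := by
  rw [← hp.2, charFn, ← Finset.sum_sub_distrib, Finset.sum_div, measOf]
  refine Finset.sum_congr rfl fun x _ => ?_
  rcases dot_eq_zero_or_one x y with h | h
  · rw [Set.indicator_of_notMem (by simpa using mem_orth.2 h), pairing_of_dot_eq_zero h]; ring
  · rw [Set.indicator_of_mem (not_mem_orth.2 h), pairing_of_dot_eq_one h]; ring

lemma orth_nonempty (y : G) : (orth y : Set G).Nonempty := ⟨0, (orth y).zero_mem⟩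

lemma exists_dot_eq_one : ∀ y : G, y ≠ 0 → ∃ g : G, dot g y = 1 := by decide +kernel

lemma orth_compl_nonempty {y : G} (hy : y ≠ 0) : (orth y : Set G)ᶜ.Nonempty := by
  obtain ⟨g, hg⟩ := exists_dot_eq_one y hy
  exact ⟨g, not_mem_orth.2 hg⟩

/-- `U` holds neither for the hyperplane orthogonal to `y` nor for its complement. -/
def NotU (p : G → ℝ) (y : G) : Prop :=
  ¬ (USet p (orth y : Set G) ∨ USet p (orth y : Set G)ᶜ)

/-- `V` holds neither for the hyperplane orthogonal to `y` nor for its complement. -/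
def NotV (p : G → ℝ) (y : G) : Prop :=
  ¬ (VSet p (orth y : Set G) ∨ VSet p (orth y : Set G)ᶜ)

lemma notU_iff {p : G → ℝ} (hp : IsProb p) {y : G} (hy : y ≠ 0) :
    NotU p y ↔ ∀ e, p e ≤ 1 / 4 + 1 / 4 * charFn p y * pairing e y := by
  rw [NotU, USet_iff (orth_nonempty y), USet_iff (orth_compl_nonempty hy), measOf_orth hp,
    measOf_orth_compl hp]
  push Not
  constructor
  · rintro ⟨h1, h2⟩ e
    rcases dot_eq_zero_or_one e y with h | h
    · rw [pairing_of_dot_eq_zero h]; linarith [h1 e (mem_orth.2 h)]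
    · rw [pairing_of_dot_eq_one h]; linarith [h2 e (not_mem_orth.2 h)]
  · intro H
    refine ⟨fun e he => ?_, fun e he => ?_⟩
    · have := H e; rw [pairing_of_dot_eq_zero (mem_orth.1 he)] at this; linarith
    · have := H e; rw [pairing_of_dot_eq_one (not_mem_orth.1 he)] at this; linarith

lemma NotV.le {p : G → ℝ} (hp : IsProb p) {y : G} (hy : y ≠ 0) (h : NotV p y) (e : G) :
    1 / 4 * charFn p y * pairing e y ≤ p e := by
  rw [NotV, VSet_iff (orth_nonempty y), VSet_iff (orth_compl_nonempty hy), measOf_orth hp,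
    measOf_orth_compl hp] at h
  push Not at h
  obtain ⟨h1, h2⟩ := h
  rcases dot_eq_zero_or_one e y with h | h
  · rw [pairing_of_dot_eq_zero h]; linarith [h1 e (mem_orth.2 h)]
  · rw [pairing_of_dot_eq_one h]; linarith [h2 e (not_mem_orth.2 h)]

lemma exists_orthogonal_pair : ∀ x y : G, dot x y = 0 →
    ∃ u : G, u ≠ 0 ∧ u + y ≠ 0 ∧ dot x u = 0 := by decide +kernel

lemma IsProb.of_combination {p : G → ℝ} (hp : IsProb p) {a b c : ℝ} {y : G} (hy : y ≠ 0)
    (hac : 8 * a + c = 1) (hnn : ∀ e, 0 ≤ a + b * pairing e y + c * p e) :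
    IsProb fun e => a + b * pairing e y + c * p e := by
  refine ⟨hnn, ?_⟩
  have h := charFn_combination p a b c y 0
  rw [charFn_zero hp, if_pos rfl, if_neg hy.symm] at h
  rw [charFn, Finset.sum_congr rfl fun x _ => by
    rw [pairing_of_dot_eq_zero (by rw [dot_comm, dot_zero_left]), one_mul]] at h
  rw [h]; linarith

lemma NotU.exists_zeros {p : G → ℝ} (hp : IsProb p) (hgt : 1 / 4 < p 0) (htec : TEC p) {y : G}
    (hy : y ≠ 0) (h : NotU p y) :
    ∃ u v : G, u ≠ 0 ∧ v ≠ 0 ∧ u + v = y ∧ charFn p u = 0 ∧ charFn p v = 0 := by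
  have hle := (notU_iff hp hy).1 h
  obtain ⟨x, hx⟩ := htec (fun e => 1 / 4 + 1 / 4 * charFn p y * pairing e y + (-1) * p e)
    (hp.of_combination hy (by norm_num) fun e => by linarith [hle e]) fun z => by
      rw [charFn_combination]
      by_cases hz : z = 0
      · subst hz; rw [charFn_zero hp, if_pos rfl, if_neg hy.symm]; norm_num
      by_cases hzy : z = y
      · subst hzy; rw [if_neg hz, if_pos rfl]; congr 1; ring
      · rw [if_neg hz, if_neg hzy, ← abs_neg]; congr 1; ring
  have hfun : charFn (fun e => 1 / 4 + 1 / 4 * charFn p y * pairing e y + (-1) * p e) =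
      charFn (fun e => p (e + x)) := congrArg charFn (funext hx)
  have key (z : G) := congrFun hfun z
  simp only [charFn_combination, charFn_shift] at key
  have hxy : dot x y = 0 := by
    rcases dot_eq_zero_or_one x y with h | h
    · exact h
    · exfalso
      have h1 := key y
      rw [if_neg hy, if_pos rfl, pairing_of_dot_eq_one h] at h1
      have h2 : charFn p y = 0 := by linarith
      have h3 := hx 0
      rw [h2] at h3
      linarith [hp.1 (0 + x)]
  have hzero (u : G) (hu : u ≠ 0) (huy : u + y ≠ 0) (hxu : dot x u = 0) : charFn p u = 0 := by
    have h1 := key u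
    rw [if_neg hu, if_neg (mt (add_eq_zero_iff_eq u y).2 huy), pairing_of_dot_eq_zero hxu] at h1
    linarith
  obtain ⟨u, hu, huy, hxu⟩ := exists_orthogonal_pair x y hxy
  refine ⟨u, u + y, hu, huy, ?_, hzero u hu huy hxu, hzero (u + y) huy ?_ ?_⟩
  · rw [← add_assoc, add_self_cancel, zero_add]
  · rwa [add_assoc, add_self_cancel, add_zero]
  · rw [dot_add_right, hxu, hxy, add_zero]

set_option synthInstance.maxHeartbeats 400000 in
set_option synthInstance.maxSize 4096 in
lemma exists_orthogonal_to_pair : ∀ u v : G, u ≠ 0 → v ≠ 0 → u + v ≠ 0 →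
    ∃ x : G, x ≠ 0 ∧ dot x (u + v) = 0 ∧
      ∀ z, dot x z = 0 → z = 0 ∨ z = u ∨ z = v ∨ z = u + v := by
  decide +kernel

/-- Two zeros of the transform balance the measure along the orthogonal direction. -/
lemma exists_balanced {p : G → ℝ} (hp : IsProb p) {u v : G} (hu : u ≠ 0) (hv : v ≠ 0)
    (huv : u + v ≠ 0) (h1 : charFn p u = 0) (h2 : charFn p v = 0) :
    ∃ x : G, x ≠ 0 ∧ dot x (u + v) = 0 ∧
      ∀ e, p e + p (e + x) = 1 / 4 + 1 / 4 * charFn p (u + v) * pairing e (u + v) := by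
  obtain ⟨x, hx, hxy, hz⟩ := exists_orthogonal_to_pair u v hu hv huv
  refine ⟨x, hx, hxy, fun e => ?_⟩
  rw [fourier_inversion p e, fourier_inversion p (e + x), ← mul_add, ← Finset.sum_add_distrib]
  have hterm (z : G) : pairing e z * charFn p z + pairing (e + x) z * charFn p z =
      (if z = 0 then 2 else 0) +
        (if z = u + v then 2 * charFn p (u + v) * pairing e (u + v) else 0) := by
    rw [pairing_add_left]
    rcases dot_eq_zero_or_one x z with h | h
    · rw [pairing_of_dot_eq_zero h]
      rcases hz z h with rfl | rfl | rfl | rfl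
      · rw [charFn_zero hp, if_pos rfl, if_neg huv.symm, pairing_comm,
          pairing_of_dot_eq_zero (dot_zero_left e)]
        norm_num
      · rw [h1, if_neg hu, if_neg (by simpa using hv)]; ring
      · rw [h2, if_neg hv, if_neg (by simpa using hu)]; ring
      · rw [if_neg huv, if_pos rfl]; ring
    · have hz0 : z ≠ 0 := by
        rintro rfl; rw [dot_comm, dot_zero_left] at h; exact zero_ne_one h
      have hzy : z ≠ u + v := by
        rintro rfl; rw [hxy] at h; exact zero_ne_one h
      rw [pairing_of_dot_eq_one h, if_neg hz0, if_neg hzy]; ring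
  simp only [hterm, Finset.sum_add_distrib, Finset.sum_ite_eq', Finset.mem_univ, if_true]
  ring

lemma notU_of_zeros {p : G → ℝ} (hp : IsProb p) {u v : G} (hu : u ≠ 0) (hv : v ≠ 0)
    (huv : u + v ≠ 0) (h1 : charFn p u = 0) (h2 : charFn p v = 0) : NotU p (u + v) := by
  obtain ⟨x, -, -, hx⟩ := exists_balanced hp hu hv huv h1 h2
  rw [notU_iff hp huv]
  intro e
  linarith [hx e, hp.1 (e + x)]

lemma charFn_add_ne_zero {p : G → ℝ} (hp : IsProb p) (hgt : 1 / 4 < p 0) {u v : G} (hu : u ≠ 0)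
    (hv : v ≠ 0) (huv : u + v ≠ 0) (h1 : charFn p u = 0) (h2 : charFn p v = 0) :
    charFn p (u + v) ≠ 0 := by
  intro h
  obtain ⟨x, -, -, hx⟩ := exists_balanced hp hu hv huv h1 h2
  have := hx 0
  rw [h] at this
  linarith [hp.1 (0 + x)]

lemma NotV.zero_or_antisymmetric {p : G → ℝ} (hp : IsProb p) (htec : TEC p) {y : G}
    (hy : y ≠ 0) (h : NotV p y) :
    charFn p y = 0 ∨ ∃ g, dot g y = 1 ∧ ∀ z, z ≠ y → dot g z = 1 → charFn p z = 0 := by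
  obtain ⟨x, hx⟩ := htec (fun e => 0 + (-(1 / 4) * charFn p y) * pairing e y + 1 * p e)
    (hp.of_combination hy (by norm_num) fun e => by linarith [h.le hp hy e]) fun z => by
      rw [charFn_combination]
      by_cases hzy : z = y
      · subst hzy; rw [if_pos rfl, ← abs_neg]; congr 1; ring
      · rw [if_neg hzy]; congr 1; ring
  have hfun : charFn (fun e => 0 + (-(1 / 4) * charFn p y) * pairing e y + 1 * p e) =
      charFn (fun e => p (e + x)) := congrArg charFn (funext hx)
  have key (z : G) := congrFun hfun z
  simp only [charFn_combination, charFn_shift] at key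
  rcases dot_eq_zero_or_one x y with hxy | hxy
  · left
    have := key y
    rw [if_pos rfl, pairing_of_dot_eq_zero hxy] at this
    linarith
  · refine Or.inr ⟨x, hxy, fun z hz hxz => ?_⟩
    have := key z
    rw [if_neg hz, pairing_of_dot_eq_one hxz] at this
    linarith

set_option synthInstance.maxHeartbeats 400000 in
set_option synthInstance.maxSize 4096 in
lemma eq_of_orthogonal_to_pair : ∀ y w : G, y ≠ 0 → w ≠ 0 → y ≠ w → ∀ s : G, s ≠ 0 →
    dot s y = 0 → dot s w = 0 → ∀ t : G, t ≠ 0 → dot t y = 0 → dot t w = 0 → s = t := by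
  decide +kernel

lemma wCond_of_zeros {p : G → ℝ} {g y : G} (hgy : dot g y = 1)
    (h : ∀ z, z ≠ y → dot g z = 1 → charFn p z = 0) : WCond p g (orth y) := by
  have hdiff (e : G) : p e - p (e + g) = 1 / 4 * (pairing e y * charFn p y) := by
    rw [fourier_inversion p e, fourier_inversion p (e + g), ← mul_sub, ← Finset.sum_sub_distrib,
      Finset.sum_eq_single y]
    · rw [pairing_add_left, pairing_of_dot_eq_one hgy]; ring
    · intro z _ hz
      rw [pairing_add_left]
      rcases dot_eq_zero_or_one g z with hg | hg
      · rw [pairing_of_dot_eq_zero hg]; ring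
      · rw [h z hz hg]; ring
    · simp
  have hy : y ≠ 0 := by
    rintro rfl; rw [dot_comm, dot_zero_left] at hgy; exact zero_ne_one hgy
  intro L hL hgL s t hsL hsK hs htL htK htg
  obtain ⟨w, hw, rfl⟩ := exists_eq_orth hL
  rw [mem_orth] at hgL hsL hsK htL
  rw [not_mem_orth] at htK
  have hyw : y ≠ w := by
    rintro rfl; rw [hgy] at hgL; exact one_ne_zero hgL
  have hst : s = t + g := by
    refine eq_of_orthogonal_to_pair y w hy hw hyw s hs hsK hsL (t + g) ?_ ?_ ?_
    · rwa [Ne, add_eq_zero_iff_eq]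
    · rw [dot_add_left, htK, hgy]; decide
    · rw [dot_add_left, htL, hgL, add_zero]
  have e0 := hdiff 0
  have es := hdiff s
  have hsg : s + g = t := by rw [hst, add_assoc, add_self_cancel, add_zero]
  rw [pairing_of_dot_eq_zero (dot_zero_left y), zero_add] at e0
  rw [pairing_of_dot_eq_zero hsK, hsg] at es
  linarith

lemma measOf_pair (p : G → ℝ) {a b : G} (hab : a ≠ b) : measOf p {a, b} = p a + p b := by
  classical
  have h (x : G) : ({a, b} : Set G).indicator p x =
      (if x = a then p a else 0) + (if x = b then p b else 0) := by
    by_cases hx : x = a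
    · subst hx; simp [hab]
    · by_cases hxb : x = b
      · subst hxb; simp [hx]
      · simp [hx, hxb]
  simp [measOf, h, Finset.sum_add_distrib]

set_option synthInstance.maxHeartbeats 400000 in
set_option synthInstance.maxSize 4096 in
lemma exists_orth_eq_quadruple : ∀ y x : G, y ≠ 0 → x ≠ 0 → dot x y = 0 →
    ∃ k : G, dot k y = 0 ∧ ∀ z, (dot z y = 0 ∧ ¬ (z = 0 ∨ z = x)) ↔ (z = k ∨ z = k + x) := by
  decide +kernel

lemma exists_balanced_halves {p : G → ℝ} {x y : G} (hy : y ≠ 0) (hx : x ≠ 0)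
    (hxy : dot x y = 0)
    (h : ∀ e, p e + p (e + x) = 1 / 4 + 1 / 4 * charFn p y * pairing e y) :
    ∃ E ⊆ (orth y : Set G), E.ncard = 2 ∧ ∀ g' : G, measOf p ((g' + ·) '' E) =
      measOf p ((g' + ·) '' ((orth y : Set G) \ E)) := by
  obtain ⟨k, hk, hq⟩ := exists_orth_eq_quadruple y x hy hx hxy
  have hdiff : (orth y : Set G) \ {0, x} = {k, k + x} := by
    ext z; exact hq z
  refine ⟨{0, x}, ?_, Set.ncard_pair hx.symm, fun g' => ?_⟩
  · rintro z (rfl | rfl)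
    · exact dot_zero_left y
    · exact hxy
  · rw [hdiff, Set.image_pair, Set.image_pair, measOf_pair p (by simpa using hx),
      measOf_pair p (by simpa using hx), add_zero, ← add_assoc, h, h, pairing_add_left,
      pairing_of_dot_eq_zero hk, mul_one]

set_option synthInstance.maxHeartbeats 400000 in
set_option synthInstance.maxSize 4096 in
lemma exists_dual_of_independent : ∀ a b : G, a ≠ 0 → b ≠ 0 → a ≠ b → ∀ c : G, c ≠ 0 → c ≠ a →
    c ≠ b → c ≠ a + b → ∃ g : G, dot g (a + b + c) = 1 ∧
      ∀ z, (dot g z = 1 → z ≠ a + b + c → z = a ∨ z = b ∨ z = c) ∧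
        (dot g z = 0 → z ≠ 0 → z = a + b ∨ z = a + c ∨ z = b + c) := by
  decide +kernel

/-- If two different hyperplanes violate `U`, then the violating hyperplanes share a direction
along which `p` satisfies the condition `W`. -/
lemma exists_common_direction {p : G → ℝ} (hp : IsProb p) (hgt : 1 / 4 < p 0) (htec : TEC p)
    {y₁ y₂ : G} (hy₁ : y₁ ≠ 0) (hy₂ : y₂ ≠ 0) (hne : y₁ ≠ y₂) (h₁ : NotU p y₁)
    (h₂ : NotU p y₂) :
    ∃ g y : G, dot g y = 1 ∧ (∀ z, z ≠ y → dot g z = 1 → charFn p z = 0) ∧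
      ∀ z, z ≠ 0 → NotU p z → dot g z = 0 := by
  obtain ⟨a, b, ha, hb, rfl, hPa, hPb⟩ := h₁.exists_zeros hp hgt htec hy₁
  have hab : a ≠ b := mt (add_eq_zero_iff_eq a b).2 hy₁
  obtain ⟨c, hc, hca, hcb, hPc⟩ : ∃ c : G, c ≠ 0 ∧ c ≠ a ∧ c ≠ b ∧ charFn p c = 0 := by
    obtain ⟨u, v, hu, hv, rfl, hPu, hPv⟩ := h₂.exists_zeros hp hgt htec hy₂
    have huv : u ≠ v := mt (add_eq_zero_iff_eq u v).2 hy₂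
    by_contra! H
    have hu' : u = a ∨ u = b := by
      by_contra! h'
      exact H u hu h'.1 h'.2 hPu
    have hv' : v = a ∨ v = b := by
      by_contra! h'
      exact H v hv h'.1 h'.2 hPv
    rcases hu' with rfl | rfl <;> rcases hv' with rfl | rfl
    · exact huv rfl
    · exact hne rfl
    · exact hne (add_comm _ _)
    · exact huv rfl
  have htri {u v : G} := charFn_add_ne_zero hp hgt (u := u) (v := v)
  have hcab : c ≠ a + b := by
    rintro rfl; exact htri ha hb hc hPa hPb hPc
  obtain ⟨g, hg, hz⟩ := exists_dual_of_independent a b ha hb hab c hc hca hcb hcab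
  refine ⟨g, a + b + c, hg, fun z hzy hgz => ?_, fun z hz0 hNz => ?_⟩
  · rcases (hz z).1 hgz hzy with rfl | rfl | rfl <;> assumption
  · have hodd (u : G) (hu : u ≠ 0) (hPu : charFn p u = 0) : dot g u = 1 := by
      rcases dot_eq_zero_or_one g u with h | h
      · rcases (hz u).2 h hu with rfl | rfl | rfl
        · exact absurd hPu (htri ha hb hu hPa hPb)
        · exact absurd hPu (htri ha hc hu hPa hPc)
        · exact absurd hPu (htri hb hc hu hPb hPc)
      · exact h
    obtain ⟨u, v, hu, hv, rfl, hPu, hPv⟩ := hNz.exists_zeros hp hgt htec hz0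
    rw [dot_add_right, hodd u hu hPu, hodd v hv hPv]; decide

/-- if `a_max = μ({0}) > 1/4` and `μ ∈ TEC(G)`, then there is a
decomposition `G = X₁ ⊕ X₂` with `X₁ = {0,g}` such that one of the conditions
II.1, II.2, II.3, II.4 holds. -/
theorem stmt8 (p : G → ℝ) (hp : IsProb p)
    (hmax : ∀ x : G, p x ≤ p 0) (hgt : 1/4 < p 0)
    (htec : TEC p) :
    ∃ (g : G) (X₁ X₂ : AddSubgroup G), g ≠ 0 ∧ g ∈ X₁ ∧
      Nat.card X₁ = 2 ∧ Nat.card X₂ = 4 ∧ X₁ ⊓ X₂ = ⊥ ∧ X₁ ⊔ X₂ = ⊤ ∧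
      ((∀ K : AddSubgroup G, Nat.card K = 4 →
          (USet p (K : Set G) ∨ USet p ((K : Set G))ᶜ) ∧
          (VSet p (K : Set G) ∨ VSet p ((K : Set G))ᶜ)) ∨
       ((∃ K : AddSubgroup G, Nat.card K = 4 ∧ g ∉ K ∧ WCond p g K) ∧
        (∀ K : AddSubgroup G, Nat.card K = 4 → g ∉ K →
          USet p (K : Set G) ∨ USet p ((K : Set G))ᶜ)) ∨
       ((∃ E ⊆ (X₂ : Set G), E.ncard = 2 ∧
          ∀ g' ∈ X₁, measOf p ((g' + ·) '' E) =
            measOf p ((g' + ·) '' ((X₂ : Set G) \ E))) ∧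
        (∀ K : AddSubgroup G, Nat.card K = 4 → K ≠ X₂ →
          USet p (K : Set G) ∨ USet p ((K : Set G))ᶜ)) ∨
       (measOf p (X₂ : Set G) = 1/2 ∧
        (∀ K : AddSubgroup G, Nat.card K = 4 → K ≠ X₂ →
          VSet p (K : Set G) ∨ VSet p ((K : Set G))ᶜ) ∧
        (∀ K : AddSubgroup G, Nat.card K = 4 →
          USet p (K : Set G) ∨ USet p ((K : Set G))ᶜ))) := by
  suffices H : ∃ g y : G, dot g y = 1 ∧
      ((∀ z, z ≠ 0 → ¬ NotU p z ∧ ¬ NotV p z) ∨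
       ((∃ w, dot g w = 1 ∧ ∀ z, z ≠ w → dot g z = 1 → charFn p z = 0) ∧
        ∀ z, z ≠ 0 → NotU p z → dot g z = 0) ∨
       (NotU p y ∧ ∀ z, z ≠ 0 → z ≠ y → ¬ NotU p z) ∨
       (charFn p y = 0 ∧ (∀ z, z ≠ 0 → z ≠ y → ¬ NotV p z) ∧ ∀ z, z ≠ 0 → ¬ NotU p z)) by
    obtain ⟨g, y, hgy, H⟩ := H
    have hne {w : G} (hgw : dot g w = 1) : g ≠ 0 ∧ w ≠ 0 := by
      constructor
      · rintro rfl; rw [dot_zero_left] at hgw; exact zero_ne_one hgw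
      · rintro rfl; rw [dot_comm, dot_zero_left] at hgw; exact zero_ne_one hgw
    obtain ⟨hg, hy⟩ := hne hgy
    refine ⟨g, line g, orth y, hg, Or.inr rfl, card_line hg, card_orth hy, line_inf_orth hgy,
      line_sup_orth hgy, ?_⟩
    rcases H with H | ⟨⟨w, hgw, hw⟩, H⟩ | ⟨hU, H⟩ | ⟨hP, hV, hU⟩
    · refine Or.inl fun K hK => ?_
      obtain ⟨z, hz, rfl⟩ := exists_eq_orth hK
      exact ⟨not_not.1 (H z hz).1, not_not.1 (H z hz).2⟩
    · refine Or.inr (Or.inl ⟨⟨orth w, card_orth (hne hgw).2, not_mem_orth.2 hgw,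
        wCond_of_zeros hgw hw⟩, fun K hK hgK => ?_⟩)
      obtain ⟨z, hz, rfl⟩ := exists_eq_orth hK
      exact not_not.1 fun h => hgK (H z hz h)
    · refine Or.inr (Or.inr (Or.inl ⟨?_, fun K hK hKy => ?_⟩))
      · obtain ⟨u, v, hu, hv, rfl, hPu, hPv⟩ := hU.exists_zeros hp hgt htec hy
        obtain ⟨x, hx, hxy, hbal⟩ := exists_balanced hp hu hv hy hPu hPv
        obtain ⟨E, hE, hcard, hE'⟩ := exists_balanced_halves hy hx hxy hbal
        exact ⟨E, hE, hcard, fun g' _ => hE' g'⟩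
      · obtain ⟨z, hz, rfl⟩ := exists_eq_orth hK
        exact not_not.1 (H z hz fun h => hKy (h ▸ rfl))
    · refine Or.inr (Or.inr (Or.inr ⟨?_, fun K hK hKy => ?_, fun K hK => ?_⟩))
      · rw [measOf_orth hp, hP, add_zero]
      · obtain ⟨z, hz, rfl⟩ := exists_eq_orth hK
        exact not_not.1 (hV z hz fun h => hKy (h ▸ rfl))
      · obtain ⟨z, hz, rfl⟩ := exists_eq_orth hK
        exact not_not.1 (hU z hz)
  by_cases hA : ∃ y, y ≠ 0 ∧ NotU p y
  · obtain ⟨y, hy, hUy⟩ := hA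
    by_cases hA' : ∃ z, z ≠ 0 ∧ z ≠ y ∧ NotU p z
    · obtain ⟨z, hz, hzy, hUz⟩ := hA'
      obtain ⟨g, w, hgw, hw, hall⟩ := exists_common_direction hp hgt htec hz hy hzy hUz hUy
      exact ⟨g, w, hgw, Or.inr (Or.inl ⟨⟨w, hgw, hw⟩, hall⟩)⟩
    · obtain ⟨g, hg⟩ := exists_dot_eq_one y hy
      exact ⟨g, y, hg, Or.inr (Or.inr (Or.inl
        ⟨hUy, fun z hz hzy h => hA' ⟨z, hz, hzy, h⟩⟩))⟩
  have hU (z : G) (hz : z ≠ 0) : ¬ NotU p z := fun h => hA ⟨z, hz, h⟩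
  by_cases hB : ∃ y, y ≠ 0 ∧ NotV p y
  · by_cases hW : ∃ g w, dot g w = 1 ∧ ∀ z, z ≠ w → dot g z = 1 → charFn p z = 0
    · obtain ⟨g, w, hgw, hw⟩ := hW
      exact ⟨g, w, hgw, Or.inr (Or.inl ⟨⟨w, hgw, hw⟩, fun z hz h => absurd h (hU z hz)⟩)⟩
    have hzero (z : G) (hz : z ≠ 0) (h : NotV p z) : charFn p z = 0 :=
      (h.zero_or_antisymmetric hp htec hz).resolve_right fun ⟨g, hg⟩ => hW ⟨g, z, hg⟩
    obtain ⟨y, hy, hVy⟩ := hB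
    obtain ⟨g, hg⟩ := exists_dot_eq_one y hy
    refine ⟨g, y, hg, Or.inr (Or.inr (Or.inr ⟨hzero y hy hVy, fun z hz hzy h => ?_, hU⟩))⟩
    have hsum : z + y ≠ 0 := mt (add_eq_zero_iff_eq z y).1 hzy
    exact hU _ hsum (notU_of_zeros hp hz hy hsum (hzero z hz h) (hzero y hy hVy))
  · obtain ⟨y, hy⟩ := exists_ne (0 : G)
    obtain ⟨g, hg⟩ := exists_dot_eq_one y hy
    exact ⟨g, y, hg, Or.inl fun z hz => ⟨hU z hz, fun h => hB ⟨z, hz, h⟩⟩⟩
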